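/- Let G be a finite group, N a normal subgroup, F a perfect splitting field of characteristic 2. An irreducible FN-module W occurs as a composition factor of the restriction to N of some self-dual irreducible FG-module if and only if W* ≅ W^g for some g ∈ G (i.e. W is G-conjugate to its dual). -/

import Mathlib

open Module

section Defs
variable {F : Type} [Field F] {G : Type} [Group G]
variable {V W : Type} [AddCommGroup V] [Module F V] [AddCommGroup W] [Module F W]

def IsSubrep (ρ : Representation F G V) (U : Submodule F V) : Prop :=
  ∀ (g : G), ∀ v ∈ U, ρ g v ∈ U

def IsIrred (ρ : Representation F G V) : Prop :=
  Nontrivial V ∧ ∀ U : Submodule F V, IsSubrep ρ U → U = ⊥ ∨ U = ⊤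

def RepIso (ρ : Representation F G V) (σ : Representation F G W) : Prop :=
  ∃ e : V ≃ₗ[F] W, ∀ (g : G) (v : V), e (ρ g v) = σ g (e v)

def IsSelfDual (ρ : Representation F G V) : Prop :=
  RepIso ρ ρ.dual

def IsTrivialRep (ρ : Representation F G V) : Prop := ∀ (g : G) (v : V), ρ g v = v

def EquivHom (σ : Representation F G W) (ρ : Representation F G V) :
    Submodule F (W →ₗ[F] V) where
  carrier := {f | ∀ (g : G) (w : W), f (σ g w) = ρ g (f w)}
  add_mem' := by
    intro f f' hf hf' g w
    simp [LinearMap.add_apply, hf g w, hf' g w]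
  zero_mem' := by intro g w; simp
  smul_mem' := by
    intro c f hf g w
    simp [LinearMap.smul_apply, hf g w]

noncomputable def repMult (σ : Representation F G W) (ρ : Representation F G V) : ℕ :=
  Module.finrank F (EquivHom σ ρ)

def BilinInvariant (ρ : Representation F G V) (B : V →ₗ[F] V →ₗ[F] F) : Prop :=
  ∀ (g : G) (v w : V), B (ρ g v) (ρ g w) = B v w

def Nondeg (B : V →ₗ[F] V →ₗ[F] F) : Prop := ∀ v : V, (∀ w : V, B v w = 0) → v = 0

def IsAltForm (B : V →ₗ[F] V →ₗ[F] F) : Prop := ∀ v : V, B v v = 0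

def PolarizesTo (Q : V → F) (B : V →ₗ[F] V →ₗ[F] F) : Prop :=
  (∀ (a : F) (v : V), Q (a • v) = a ^ 2 * Q v) ∧
    ∀ v w : V, Q (v + w) = Q v + B v w + Q w

def QuadInvariant (ρ : Representation F G V) (Q : V → F) : Prop :=
  ∀ (g : G) (v : V), Q (ρ g v) = Q v

def HasQuadType (ρ : Representation F G V) : Prop :=
  ∃ (Q : V → F) (B : V →ₗ[F] V →ₗ[F] F),
    PolarizesTo Q B ∧ QuadInvariant ρ Q ∧ Nondeg B

def IsSplitting (F G : Type) [Field F] [Group G] : Prop :=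
  ∀ (V : Type) [AddCommGroup V] [Module F V] (ρ : Representation F G V),
    FiniteDimensional F V → IsIrred ρ →
      ∀ f ∈ EquivHom ρ ρ, ∃ c : F, f = c • (LinearMap.id : V →ₗ[F] V)

structure RepOn (F G : Type) [Field F] [Group G] where
  carrier : Type
  [ag : AddCommGroup carrier]
  [md : Module F carrier]
  rep : Representation F G carrier

attribute [instance] RepOn.ag RepOn.md

end Defs

theorem exists_algHom_pi_matrix (F A : Type) [Field F] [Ring A] [Algebra F A] [Module.Finite F A] :
    ∃ (n : ℕ) (D : Fin n → Type) (d : Fin n → ℕ) (_ : ∀ i, DivisionRing (D i))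
      (_ : ∀ i, Algebra F (D i)) (_ : ∀ i, Module.Finite F (D i)) (_ : ∀ i, NeZero (d i))
      (Φ : A →ₐ[F] Π i, Matrix (Fin (d i)) (Fin (d i)) (D i)),
      Function.Surjective Φ ∧ ∀ x, Φ x = 0 → IsNilpotent x := by
  have : IsArtinianRing A := IsArtinianRing.of_finite F A
  have hss : IsSemisimpleRing (A ⧸ Ring.jacobson A) := IsSemiprimaryRing.isSemisimpleRing
  obtain ⟨n, D, d, _, _, hf, hd, ⟨e⟩⟩ :=
    IsSemisimpleRing.exists_algEquiv_pi_matrix_divisionRing_finite F (A ⧸ Ring.jacobson A)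
  refine ⟨n, D, d, inferInstance, inferInstance, hf, hd,
    e.toAlgHom.comp (Ideal.Quotient.mkₐ F (Ring.jacobson A)), ?_, fun x hx ↦ ?_⟩
  · exact e.surjective.comp Ideal.Quotient.mk_surjective
  · have hx' : x ∈ Ring.jacobson A := by
      apply Ideal.Quotient.eq_zero_iff_mem.mp
      apply e.injective
      simpa using hx
    obtain ⟨k, hk⟩ := IsSemiprimaryRing.isNilpotent (R := A)
    exact ⟨k, by simpa [hk] using Ideal.pow_mem_pow hx' k⟩

section Irreducible

variable {F : Type} [Field F] {G : Type} [Group G]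
variable {V W : Type} [AddCommGroup V] [Module F V] [AddCommGroup W] [Module F W]

theorem IsSubrep.asAlgebraHom_mem {ρ : Representation F G V} {U : Submodule F V}
    (hU : IsSubrep ρ U) (x : MonoidAlgebra F G) {v : V} (hv : v ∈ U) :
    ρ.asAlgebraHom x v ∈ U := by
  induction x using MonoidAlgebra.induction_linear with
  | zero => simp
  | add x y hx hy => simpa using U.add_mem hx hy
  | single g r => simpa using U.smul_mem r (hU g v hv)

theorem IsIrred.exists_asAlgebraHom_eq {ρ : Representation F G V} (h : IsIrred ρ) {v : V}
    (hv : v ≠ 0) (w : V) : ∃ x, ρ.asAlgebraHom x v = w := by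
  have hsub : IsSubrep ρ (LinearMap.range (ρ.asAlgebraHom.toLinearMap.flip v)) := by
    rintro g _ ⟨x, rfl⟩
    exact ⟨MonoidAlgebra.single g 1 * x, by simp⟩
  rcases h.2 _ hsub with h' | h'
  · exact absurd (by simpa [h'] using LinearMap.mem_range_self (ρ.asAlgebraHom.toLinearMap.flip v) 1)
      hv
  · have : w ∈ LinearMap.range (ρ.asAlgebraHom.toLinearMap.flip v) := h' ▸ Submodule.mem_top
    simpa using this

theorem isIrred_of_forall_exists {ρ : Representation F G V} [Nontrivial V]
    (h : ∀ v : V, v ≠ 0 → ∀ w, ∃ x, ρ.asAlgebraHom x v = w) : IsIrred ρ := by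
  refine ⟨‹_›, fun U hU ↦ or_iff_not_imp_left.mpr fun hne ↦ ?_⟩
  obtain ⟨v, hv, hv0⟩ := U.ne_bot_iff.mp hne
  refine U.eq_top_iff'.mpr fun w ↦ ?_
  obtain ⟨x, rfl⟩ := h v hv0 w
  exact hU.asAlgebraHom_mem x hv

theorem IsIrred.repIso_of_ne_zero {ρ : Representation F G V} {σ : Representation F G W}
    (hρ : IsIrred ρ) (hσ : IsIrred σ) (T : V →ₗ[F] W) (hT : ∀ g v, T (ρ g v) = σ g (T v))
    (hne : T ≠ 0) : RepIso ρ σ := by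
  have hker : LinearMap.ker T = ⊥ := by
    refine (hρ.2 (LinearMap.ker T) fun g v hv ↦ ?_).resolve_right
      fun h ↦ hne (LinearMap.ker_eq_top.mp h)
    rw [LinearMap.mem_ker] at hv ⊢
    rw [hT, hv, map_zero]
  have hrange : LinearMap.range T = ⊤ := by
    refine (hσ.2 (LinearMap.range T) ?_).resolve_left
      fun h ↦ hne (LinearMap.range_eq_bot.mp h)
    rintro g _ ⟨v, rfl⟩
    exact ⟨_, hT g v⟩
  exact ⟨LinearEquiv.ofBijective T ⟨LinearMap.ker_eq_bot.mp hker, LinearMap.range_eq_top.mp hrange⟩,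
    hT⟩

/-- A matrix algebra over a division algebra acting on column vectors. -/
def mulVecAlgHom (F D : Type) [Field F] [DivisionRing D] [Algebra F D] (n : ℕ) :
    Matrix (Fin n) (Fin n) D →ₐ[F] Module.End F (Fin n → D) :=
  AlgHom.ofLinearMap
    { toFun := fun M ↦
        { toFun := fun v ↦ M.mulVec v
          map_add' := fun v w ↦ Matrix.mulVec_add M v w
          map_smul' := fun c v ↦ Matrix.mulVec_smul M c v }
      map_add' := fun M M' ↦ by refine LinearMap.ext fun v ↦ ?_; exact Matrix.add_mulVec M M' v
      map_smul' := fun c M ↦ by refine LinearMap.ext fun v ↦ ?_; exact Matrix.smul_mulVec c M v }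
    (by refine LinearMap.ext fun v ↦ ?_; exact Matrix.one_mulVec v)
    (fun M M' ↦ by refine LinearMap.ext fun v ↦ ?_; exact (Matrix.mulVec_mulVec v M M').symm)

theorem mulVecAlgHom_apply (F D : Type) [Field F] [DivisionRing D] [Algebra F D] (n : ℕ)
    (M : Matrix (Fin n) (Fin n) D) (v : Fin n → D) : mulVecAlgHom F D n M v = M.mulVec v := rfl

theorem exists_mulVec_eq {D : Type} [DivisionRing D] {n : ℕ} {v : Fin n → D} (hv : v ≠ 0)
    (w : Fin n → D) : ∃ M : Matrix (Fin n) (Fin n) D, M.mulVec v = w := by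
  obtain ⟨k, hk⟩ := Function.ne_iff.mp hv
  refine ⟨Matrix.vecMulVec w (Pi.single k (v k)⁻¹), funext fun i ↦ ?_⟩
  simp [Matrix.vecMulVec_mulVec, inv_mul_cancel₀ hk]

/-- The representation on column vectors attached to a homomorphism into a matrix algebra. -/
noncomputable def columnRep {D : Type} [DivisionRing D] [Algebra F D] {n : ℕ}
    (Φ : MonoidAlgebra F G →ₐ[F] Matrix (Fin n) (Fin n) D) : Representation F G (Fin n → D) :=
  (MonoidAlgebra.lift F _ G).symm ((mulVecAlgHom F D n).comp Φ)

theorem columnRep_asAlgebraHom {D : Type} [DivisionRing D] [Algebra F D] {n : ℕ}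
    (Φ : MonoidAlgebra F G →ₐ[F] Matrix (Fin n) (Fin n) D) :
    (columnRep Φ).asAlgebraHom = (mulVecAlgHom F D n).comp Φ := by
  simp [columnRep, Representation.asAlgebraHom_def]

theorem columnRep_isIrred {D : Type} [DivisionRing D] [Algebra F D] {n : ℕ} [NeZero n]
    {Φ : MonoidAlgebra F G →ₐ[F] Matrix (Fin n) (Fin n) D} (hΦ : Function.Surjective Φ) :
    IsIrred (columnRep Φ) := by
  refine isIrred_of_forall_exists fun v hv w ↦ ?_
  obtain ⟨M, hM⟩ := exists_mulVec_eq hv w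
  obtain ⟨x, rfl⟩ := hΦ M
  exact ⟨x, by rw [columnRep_asAlgebraHom]; exact hM⟩

theorem algebraMap_bijective_of_isSplitting (hs : IsSplitting F G) {D : Type} [DivisionRing D]
    [Algebra F D] [Module.Finite F D] {n : ℕ} [NeZero n]
    {Φ : MonoidAlgebra F G →ₐ[F] Matrix (Fin n) (Fin n) D} (hΦ : Function.Surjective Φ) :
    Function.Bijective (algebraMap F D) := by
  refine ⟨(algebraMap F D).injective, fun a ↦ ?_⟩
  let f : (Fin n → D) →ₗ[F] (Fin n → D) :=
    { toFun := fun v i ↦ v i * a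
      map_add' := fun v w ↦ by ext; simp [add_mul]
      map_smul' := fun c v ↦ by ext; simp }
  have hf : f ∈ EquivHom (columnRep Φ) (columnRep Φ) := by
    intro g v
    rw [← Representation.asAlgebraHom_single_one, columnRep_asAlgebraHom]
    ext i
    simp [f, mulVecAlgHom_apply, Matrix.mulVec, dotProduct, Finset.sum_mul, mul_assoc]
  obtain ⟨c, hc⟩ := hs _ (columnRep Φ) inferInstance (columnRep_isIrred hΦ) f hf
  refine ⟨c, ?_⟩
  have := congrFun (LinearMap.congr_fun hc fun _ ↦ (1 : D)) 0
  simpa [f, Algebra.smul_def] using this.symm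

theorem exists_algHom_matrix [Finite G] (hs : IsSplitting F G) :
    ∃ (n : ℕ) (d : Fin n → ℕ) (_ : ∀ i, NeZero (d i))
      (Φ : MonoidAlgebra F G →ₐ[F] Π i, Matrix (Fin (d i)) (Fin (d i)) F),
      Function.Surjective Φ ∧ ∀ x, Φ x = 0 → IsNilpotent x := by
  obtain ⟨n, D, d, _, _, _, _, Φ, hΦ, hnil⟩ := exists_algHom_pi_matrix F (MonoidAlgebra F G)
  have hbij (i) : Function.Bijective (algebraMap F (D i)) :=
    algebraMap_bijective_of_isSplitting hs (Φ := (Pi.evalAlgHom F _ i).comp Φ)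
      ((Function.surjective_eval i).comp hΦ)
  let e : (Π i, Matrix (Fin (d i)) (Fin (d i)) (D i)) ≃ₐ[F]
      Π i, Matrix (Fin (d i)) (Fin (d i)) F :=
    AlgEquiv.piCongrRight fun i ↦
      (AlgEquiv.ofBijective (Algebra.ofId F (D i)) (hbij i)).symm.mapMatrix
  refine ⟨n, d, inferInstance, e.toAlgHom.comp Φ, e.surjective.comp hΦ, fun x hx ↦ hnil x ?_⟩
  exact e.injective (by simpa using hx)

theorem linearMap_matrix_eq_mul_trace {n : Type} [Fintype n] [DecidableEq n]
    (f : Matrix n n F →ₗ[F] F) (hf : ∀ M M', f (M * M') = f (M' * M)) (k : n) (M : Matrix n n F) :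
    f M = f (Matrix.single k k 1) * M.trace := by
  have key (i j : n) (c : F) :
      f (Matrix.single i j c) = f (Matrix.single k k 1) * (Matrix.single i j c).trace := by
    have h1 : Matrix.single i j c = Matrix.single i k c * Matrix.single k j 1 := by simp
    by_cases hij : i = j
    · subst hij
      conv_lhs => rw [h1, hf]
      rw [Matrix.single_mul_single_same, one_mul, Matrix.trace_single_eq_same,
        ← mul_one c, ← smul_eq_mul c 1, ← Matrix.smul_single, map_smul, smul_eq_mul, mul_comm,
        smul_eq_mul, mul_one]
    · rw [h1, hf]
      simp [Matrix.single_mul_single_of_ne, Ne.symm hij, hij]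
  conv_lhs => rw [Matrix.matrix_eq_sum_single M]
  conv_rhs => rw [Matrix.matrix_eq_sum_single M]
  simp only [map_sum, Matrix.trace_sum, Finset.mul_sum]
  exact Finset.sum_congr rfl fun i _ ↦ Finset.sum_congr rfl fun j _ ↦ key i j _

/-- A finite group over a splitting field has a complete finite list of irreducible
representations, separated by elements of the group algebra; every trace-like functional is a
combination of their traces. -/
theorem exists_irreducibles [Finite G] (hs : IsSplitting F G) :
    ∃ (n : ℕ) (d : Fin n → ℕ) (ρ : ∀ i, Representation F G (Fin (d i) → F))
      (ε : Fin n → MonoidAlgebra F G),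
      (∀ i, IsIrred (ρ i)) ∧ (∀ i j, j ≠ i → (ρ j).asAlgebraHom (ε i) = 0) ∧
      (∀ i, LinearMap.trace F _ ((ρ i).asAlgebraHom (ε i)) = 1) ∧
      (∀ (S : Type) [AddCommGroup S] [Module F S] (σ : Representation F G S), IsIrred σ →
        ∃ i, RepIso (ρ i) σ) ∧
      ∀ f : MonoidAlgebra F G →ₗ[F] F, (∀ x y, f (x * y) = f (y * x)) →
        (∀ x, IsNilpotent x → f x = 0) →
        ∀ x, f x = ∑ i, f (ε i) * LinearMap.trace F _ ((ρ i).asAlgebraHom x) := by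
  obtain ⟨n, d, _, Φ, hΦ, hnil⟩ := exists_algHom_matrix hs
  obtain ⟨s, hs⟩ := Φ.toLinearMap.exists_rightInverse_of_surjective
    (LinearMap.range_eq_top.mpr hΦ)
  replace hs (M) : Φ (s M) = M := LinearMap.congr_fun hs M
  let Ψ (i : Fin n) : MonoidAlgebra F G →ₐ[F] Matrix (Fin (d i)) (Fin (d i)) F :=
    (Pi.evalAlgHom F _ i).comp Φ
  have hΨ (i) : Function.Surjective (Ψ i) := (Function.surjective_eval i).comp hΦ
  have hΨs (i M) : Ψ i (s M) = M i := congrFun (hs M) i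
  have hact (i x v) : (columnRep (Ψ i)).asAlgebraHom x v = (Ψ i x).mulVec v := by
    rw [columnRep_asAlgebraHom]; rfl
  have htr (i x) : LinearMap.trace F _ ((columnRep (Ψ i)).asAlgebraHom x) = (Ψ i x).trace := by
    rw [← Matrix.trace_toLin'_eq]
    congr 1
    refine LinearMap.ext fun v ↦ ?_
    simp [hact]
  refine ⟨n, d, fun i ↦ columnRep (Ψ i), fun i ↦ s (Pi.single i (Matrix.single 0 0 1)),
    fun i ↦ columnRep_isIrred (hΨ i), fun i j hij ↦ ?_, fun i ↦ ?_, ?_, ?_⟩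
  · refine LinearMap.ext fun v ↦ ?_
    simp [hact, hΨs, hij]
  · simp [htr, hΨs]
  · intro S _ _ σ hσ
    have hker (x) (hx : Φ x = 0) : σ.asAlgebraHom x = 0 := by
      by_contra hne
      obtain ⟨v, hv⟩ := DFunLike.ne_iff.mp hne
      obtain ⟨y, hy⟩ := hσ.exists_asAlgebraHom_eq hv v
      obtain ⟨k, hk⟩ := hnil (y * x) (by simp [hx])
      have hfix : σ.asAlgebraHom (y * x) v = v := by simpa using hy
      have : σ.asAlgebraHom ((y * x) ^ k) v = v := by
        rw [map_pow, Module.End.pow_apply]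
        exact Function.iterate_fixed hfix k
      rw [hk] at this
      simp only [map_zero, LinearMap.zero_apply] at this
      simp [← this] at hv
    have hcongr (x y) (hxy : Φ x = Φ y) : σ.asAlgebraHom x = σ.asAlgebraHom y := by
      rw [← sub_eq_zero, ← map_sub]
      exact hker _ (by simp [hxy])
    obtain ⟨v, hv⟩ := @exists_ne S hσ.1 0
    have hsum : ∑ i, ∑ k, σ.asAlgebraHom (s (Pi.single i (Matrix.single k k 1))) v = v := by
      have : σ.asAlgebraHom (∑ i, ∑ k, s (Pi.single i (Matrix.single k k 1))) =
          σ.asAlgebraHom 1 := by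
        apply hcongr
        simp only [map_sum, hs, map_one]
        ext1 i
        rw [Finset.sum_apply, Finset.sum_eq_single i (by intro j _ hj; simp [hj.symm]) (by simp)]
        simp [Matrix.sum_single_one]
      simpa using LinearMap.congr_fun this v
    obtain ⟨i, k, hik⟩ : ∃ i k, σ.asAlgebraHom (s (Pi.single i (Matrix.single k k 1))) v ≠ 0 := by
      by_contra! h
      simp [h] at hsum
      exact hv hsum.symm
    refine ⟨i, ?_⟩
    let T : (Fin (d i) → F) →ₗ[F] S :=
      { toFun := fun w ↦ σ.asAlgebraHom
          (s (Pi.single i (Matrix.vecMulVec w (Pi.single k 1)))) v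
        map_add' := fun w w' ↦ by
          simp [Matrix.add_vecMulVec, Pi.single_add]
        map_smul' := fun c w ↦ by
          simp [Matrix.smul_vecMulVec, Pi.single_smul] }
    have hT (g w) : T (columnRep (Ψ i) g w) = σ g (T w) := by
      rw [← Representation.asAlgebraHom_single_one, ← Representation.asAlgebraHom_single_one, hact]
      simp only [T, LinearMap.coe_mk, AddHom.coe_mk]
      rw [← Module.End.mul_apply, ← map_mul]
      congr 1
      apply hcongr
      rw [map_mul, hs, hs]
      ext1 j
      by_cases hj : j = i
      · subst hj
        simp [Matrix.mul_vecMulVec, Ψ]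
      · simp [hj]
    refine (columnRep_isIrred (hΨ i)).repIso_of_ne_zero hσ T hT fun h0 ↦ hik ?_
    rw [Matrix.single_eq_single_vecMulVec_single]
    exact LinearMap.congr_fun h0 (Pi.single k 1)
  · intro f hf hf0 x
    let fb := f ∘ₗ s
    have hcongr (x y) (hxy : Φ x = Φ y) : f x = f y := by
      rw [← sub_eq_zero, ← map_sub]
      exact hf0 _ (hnil _ (by simp [hxy]))
    have hfb (M M') : fb (M * M') = fb (M' * M) := by
      calc f (s (M * M')) = f (s M * s M') := hcongr _ _ (by simp [hs])
        _ = f (s M' * s M) := hf _ _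
        _ = f (s (M' * M)) := hcongr _ _ (by simp [hs])
    have hx : Φ x = ∑ i, Pi.single i (Ψ i x) := by
      exact (Finset.univ_sum_single (Φ x)).symm
    calc f x = fb (Φ x) := hcongr _ _ (hs _).symm
      _ = ∑ i, fb (Pi.single i (Ψ i x)) := by rw [hx, map_sum]
      _ = _ := Finset.sum_congr rfl fun i _ ↦ by
        rw [htr]
        refine linearMap_matrix_eq_mul_trace (fb ∘ₗ LinearMap.single F
          (fun i ↦ Matrix (Fin (d i)) (Fin (d i)) F) i) (fun M M' ↦ ?_) 0 _
        simp only [LinearMap.comp_apply, LinearMap.single_apply]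
        rw [Pi.single_mul, Pi.single_mul]
        exact hfb (Pi.single i M) (Pi.single i M')

end Irreducible

section Functional

variable {F : Type} [Field F] {G : Type} [Group G]

/-- The linear extension of a function on a group to the group algebra. -/
noncomputable def linearExtension (c : G → F) : MonoidAlgebra F G →ₗ[F] F :=
  (MonoidAlgebra.basis G F).constr F c

@[simp]
theorem linearExtension_single (c : G → F) (g : G) (r : F) :
    linearExtension c (MonoidAlgebra.single g r) = r * c g := by
  have : MonoidAlgebra.single g r = r • MonoidAlgebra.basis G F g := by simp
  rw [this, map_smul, linearExtension, Module.Basis.constr_basis, smul_eq_mul]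

theorem linearExtension_eq_sum [Fintype G] (c : G → F) (x : MonoidAlgebra F G) :
    linearExtension c x = ∑ g, x.coeff g * c g := by
  induction x using MonoidAlgebra.induction_linear with
  | zero => simp
  | add x y hx hy => simp [hx, hy, add_mul, Finset.sum_add_distrib]
  | single g r => classical simp [Finsupp.single_apply, ite_mul]

theorem linearExtension_sum_mul [Finite G] {ι : Type} (s : Finset ι) (a : ι → F) (c : ι → G → F)
    (x : MonoidAlgebra F G) :
    linearExtension (fun g ↦ ∑ i ∈ s, a i * c i g) x = ∑ i ∈ s, a i * linearExtension (c i) x := by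
  have := Fintype.ofFinite G
  simp only [linearExtension_eq_sum, Finset.mul_sum]
  rw [Finset.sum_comm]
  exact Finset.sum_congr rfl fun i _ ↦ Finset.sum_congr rfl fun g _ ↦ by ring

theorem linearExtension_mul_comm {c : G → F} (hc : ∀ g h, c (g * h) = c (h * g))
    (x y : MonoidAlgebra F G) : linearExtension c (x * y) = linearExtension c (y * x) := by
  induction x using MonoidAlgebra.induction_linear with
  | zero => simp
  | add x x' hx hx' => simp [add_mul, mul_add, hx, hx']
  | single g r =>
    induction y using MonoidAlgebra.induction_linear with
    | zero => simp
    | add x x' hx hx' => simp [add_mul, mul_add, hx, hx']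
    | single h s => simp [MonoidAlgebra.single_mul_single, hc g h, mul_comm r s]

theorem linearExtension_character {V : Type} [AddCommGroup V] [Module F V]
    (ρ : Representation F G V) (x : MonoidAlgebra F G) :
    linearExtension ρ.character x = LinearMap.trace F V (ρ.asAlgebraHom x) := by
  induction x using MonoidAlgebra.induction_linear with
  | zero => simp
  | add x y hx hy => simp [hx, hy]
  | single g r => simp [Representation.character]

/-- In characteristic two, a trace-like functional is additive on `2 ^ k`-th powers. -/
theorem map_add_pow_two_pow {A : Type} [Ring A] [CharP F 2] (f : A →+ F)
    (hf : ∀ x y, f (x * y) = f (y * x)) (k : ℕ) :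
    (∀ x y, f ((x + y) ^ 2 ^ k) = f (x ^ 2 ^ k) + f (y ^ 2 ^ k)) ∧
      ∀ x y, f ((x * y) ^ 2 ^ k) = f ((y * x) ^ 2 ^ k) := by
  induction k with
  | zero => simpa using hf
  | succ k ih =>
    obtain ⟨hadd, hmul⟩ := ih
    simp only [pow_succ' 2 k, pow_mul]
    refine ⟨fun x y ↦ ?_, fun x y ↦ ?_⟩
    · have : (x + y) ^ 2 = x ^ 2 + (x * y + y * x) + y ^ 2 := by noncomm_ring
      rw [this, hadd, hadd, hadd, hmul y x, CharTwo.add_self_eq_zero, add_zero]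
    · have : (x * y) ^ 2 = x * (y * x * y) := by noncomm_ring
      rw [this, hmul]
      congr 2
      noncomm_ring

theorem linearExtension_pow_two_pow [CharP F 2] {c : G → F} (hc : ∀ g h, c (g * h) = c (h * g))
    (k : ℕ) (x : MonoidAlgebra F G) :
    linearExtension (fun g ↦ c g ^ 2 ^ k) (x ^ 2 ^ k) =
      linearExtension (fun g ↦ c (g ^ 2 ^ k)) x ^ 2 ^ k := by
  induction x using MonoidAlgebra.induction_linear with
  | zero => simp
  | add x y hx hy =>
    have := (map_add_pow_two_pow (linearExtension (fun g ↦ c g ^ 2 ^ k)).toAddMonoidHom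
      (linearExtension_mul_comm fun g h ↦ by rw [hc]) k).1 x y
    simp only [LinearMap.toAddMonoidHom_coe] at this
    rw [this, hx, hy, map_add, add_pow_char_pow]
  | single g r => simp [MonoidAlgebra.single_pow, mul_pow]

theorem exists_pow_two_pow_idempotent (G : Type) [Group G] [Finite G] :
    ∃ a : ℕ, 0 < a ∧ ∀ g : G, (g ^ 2 ^ a) ^ 2 ^ a = g ^ 2 ^ a := by
  obtain ⟨s, m, hm, hs⟩ := Nat.exists_eq_two_pow_mul_odd (Nat.card_pos (α := G)).ne'
  have hpos : 1 ≤ m.totient := Nat.totient_pos.mpr hm.pos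
  refine ⟨(s + 1) * m.totient, Nat.mul_pos s.succ_pos hpos, fun g ↦ ?_⟩
  have h1 : 2 ^ ((s + 1) * m.totient) ≡ 1 [MOD m] := by
    have := (Nat.ModEq.pow_totient (Nat.coprime_two_left.mpr hm)).pow (s + 1)
    rwa [← pow_mul, one_pow, mul_comm] at this
  have h2 : 2 ^ s ∣ 2 ^ ((s + 1) * m.totient) := pow_dvd_pow _ (by nlinarith)
  have h3 : 2 ^ ((s + 1) * m.totient) * 2 ^ ((s + 1) * m.totient) ≡
      2 ^ ((s + 1) * m.totient) [MOD Nat.card G] := by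
    rw [hs, ← Nat.modEq_and_modEq_iff_modEq_mul ((Nat.coprime_two_left.mpr hm).pow_left s)]
    constructor
    · exact (Nat.modEq_zero_iff_dvd.mpr (h2.mul_right _)).trans
        (Nat.modEq_zero_iff_dvd.mpr h2).symm
    · simpa using h1.mul_left (2 ^ ((s + 1) * m.totient))
  rw [← pow_mul]
  exact pow_eq_pow_iff_modEq.mpr (h3.of_dvd (orderOf_dvd_natCard g))

theorem pow_two_pow_mul_of_idempotent {a : ℕ} (ha : ∀ g : G, (g ^ 2 ^ a) ^ 2 ^ a = g ^ 2 ^ a)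
    (g : G) (m : ℕ) : g ^ 2 ^ (a * (m + 1)) = g ^ 2 ^ a := by
  induction m with
  | zero => simp
  | succ m ih => rw [mul_add_one, pow_add, pow_mul, ih, ha]

theorem linearExtension_eq_zero_of_isNilpotent [CharP F 2] {c : G → F}
    (hc : ∀ g h, c (g * h) = c (h * g)) {a : ℕ} (ha0 : 0 < a)
    (ha : ∀ g : G, (g ^ 2 ^ a) ^ 2 ^ a = g ^ 2 ^ a) {x : MonoidAlgebra F G} (hx : IsNilpotent x) :
    linearExtension (fun g ↦ c (g ^ 2 ^ a)) x = 0 := by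
  obtain ⟨n, hn⟩ := hx
  have hle : n ≤ 2 ^ (a * (n + 1)) :=
    Nat.lt_two_pow_self.le.trans (Nat.pow_le_pow_right two_pos (by nlinarith))
  have key := linearExtension_pow_two_pow hc (a * (n + 1)) x
  simp only [pow_two_pow_mul_of_idempotent ha, pow_eq_zero_of_le hle hn, map_zero] at key
  exact eq_zero_of_pow_eq_zero key.symm

theorem character_pow_two_pow [CharP F 2] {V : Type} [AddCommGroup V] [Module F V]
    (ρ : Representation F G V) {a : ℕ} (ha : ∀ g : G, (g ^ 2 ^ a) ^ 2 ^ a = g ^ 2 ^ a) (g : G) :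
    ρ.character (g ^ 2 ^ a) = ρ.character g := by
  have : CharP (MonoidAlgebra F G) 2 :=
    charP_of_injective_algebraMap (algebraMap F (MonoidAlgebra F G)).injective 2
  have hnil : IsNilpotent
      (MonoidAlgebra.single g (1 : F) - MonoidAlgebra.single (g ^ 2 ^ a) 1) := by
    refine ⟨2 ^ a, ?_⟩
    rw [sub_pow_char_pow_of_commute]
    · simp [MonoidAlgebra.single_pow, ha]
    · simp [Commute, SemiconjBy, MonoidAlgebra.single_mul_single, ← pow_succ, ← pow_succ']
  have htr := (LinearMap.isNilpotent_trace_of_isNilpotent (hnil.map ρ.asAlgebraHom)).eq_zero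
  rw [← linearExtension_character] at htr
  simp only [map_sub, linearExtension_single, one_mul, sub_eq_zero] at htr
  exact htr.symm

end Functional

section Constructions

variable {F : Type} [Field F] {G : Type} [Group G]
variable {V W : Type} [AddCommGroup V] [Module F V] [AddCommGroup W] [Module F W]

theorem RepIso.symm {ρ : Representation F G V} {σ : Representation F G W} (h : RepIso ρ σ) :
    RepIso σ ρ := by
  obtain ⟨e, he⟩ := h
  exact ⟨e.symm, fun g w ↦ e.injective (by simp [he])⟩

theorem asAlgebraHom_apply_of_intertwining {ρ : Representation F G V} {σ : Representation F G W}
    (T : V →ₗ[F] W) (hT : ∀ g v, T (ρ g v) = σ g (T v)) (x : MonoidAlgebra F G) (v : V) :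
    T (ρ.asAlgebraHom x v) = σ.asAlgebraHom x (T v) := by
  induction x using MonoidAlgebra.induction_linear with
  | zero => simp
  | add x y hx hy => simp [hx, hy]
  | single g r => simp [hT]

theorem RepIso.character_eq {ρ : Representation F G V} {σ : Representation F G W}
    (h : RepIso ρ σ) : ρ.character = σ.character := by
  obtain ⟨e, he⟩ := h
  ext g
  rw [Representation.character, Representation.character, ← LinearMap.trace_conj' (ρ g) e]
  congr 1
  ext w
  simp [LinearEquiv.conj_apply, he]

theorem IsIrred.dual [FiniteDimensional F V] {ρ : Representation F G V} (h : IsIrred ρ) :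
    IsIrred ρ.dual := by
  have := h.1
  refine ⟨inferInstance, fun U hU ↦ ?_⟩
  have hsub : IsSubrep ρ U.dualCoannihilator := by
    intro g v hv
    rw [Submodule.mem_dualCoannihilator] at hv ⊢
    intro φ hφ
    simpa [Module.Dual.transpose_apply] using hv _ (hU g⁻¹ φ hφ)
  rcases h.2 _ hsub with h' | h'
  · right
    rw [← Subspace.dualCoannihilator_dualAnnihilator_eq (W := U), h', Submodule.dualAnnihilator_bot]
  · left
    rw [← Subspace.dualCoannihilator_dualAnnihilator_eq (W := U), h', Submodule.dualAnnihilator_top]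

theorem IsIrred.comp_surjective {H : Type} [Group H] {ρ : Representation F G V} (h : IsIrred ρ)
    {f : H →* G} (hf : Function.Surjective f) :
    IsIrred (V := V) (ρ.comp f : Representation F H V) := by
  refine ⟨h.1, fun U hU ↦ h.2 U fun g v hv ↦ ?_⟩
  obtain ⟨k, rfl⟩ := hf g
  exact hU k v hv

theorem isSplitting_of_top (hs : IsSplitting F (⊤ : Subgroup G)) : IsSplitting F G := by
  intro V _ _ ρ hfd hρ f hf
  exact hs V (ρ.comp (⊤ : Subgroup G).subtype) hfd
    (hρ.comp_surjective fun g ↦ ⟨⟨g, trivial⟩, rfl⟩) f fun g v ↦ hf g v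

/-- The restriction of a representation to a subrepresentation. -/
def restrictSubrep (ρ : Representation F G V) {U : Submodule F V} (hU : IsSubrep ρ U) :
    Representation F G U where
  toFun g := (ρ g).restrict (hU g)
  map_one' := by ext; simp
  map_mul' g h := by ext; simp

theorem exists_isIrred_restrictSubrep [FiniteDimensional F V] [Nontrivial V]
    (ρ : Representation F G V) :
    ∃ (U : Submodule F V) (hU : IsSubrep ρ U), IsIrred (restrictSubrep ρ hU) := by
  obtain ⟨U, ⟨hne, hU⟩, hmin⟩ := WellFounded.has_min (wellFounded_lt (α := Submodule F V))
    {U | U ≠ ⊥ ∧ IsSubrep ρ U} ⟨⊤, top_ne_bot, fun _ _ _ ↦ trivial⟩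
  refine ⟨U, hU, Submodule.nontrivial_iff_ne_bot.mpr hne, fun X hX ↦ or_iff_not_imp_left.mpr ?_⟩
  intro hX0
  have hsub : IsSubrep ρ (X.map U.subtype) := by
    rintro g _ ⟨v, hv, rfl⟩
    exact ⟨_, hX g v hv, rfl⟩
  have hnlt := hmin (X.map U.subtype)
    ⟨fun h0 ↦ hX0 (Submodule.map_injective_of_injective U.injective_subtype
      (by rw [h0, Submodule.map_bot])), hsub⟩
  have heq : X.map U.subtype = U := (Submodule.map_subtype_le U X).eq_of_not_lt hnlt
  refine X.eq_top_iff'.mpr fun u ↦ ?_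
  have hu : (u : V) ∈ X.map U.subtype := by rw [heq]; exact u.2
  obtain ⟨v, hv, hvu⟩ := hu
  rwa [← Subtype.ext (show (v : V) = u from hvu)]

end Constructions

section Clifford

variable {F : Type} [Field F] {G : Type} [Group G] {N : Subgroup G} [N.Normal]
variable {V W : Type} [AddCommGroup V] [Module F V] [AddCommGroup W] [Module F W]

/-- The conjugate of a representation of a normal subgroup. -/
abbrev conjRep (σ : Representation F N W) (g : G) : Representation F N W :=
  σ.comp (MulAut.conjNormal g).toMonoidHom

theorem IsIrred.conjRep {σ : Representation F N W} (h : IsIrred σ) (g : G) :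
    IsIrred (conjRep σ g) :=
  h.comp_surjective (MulAut.conjNormal g).surjective

theorem conjRep_conj (ρ : Representation F G V) (g : G) (n : N) (v : V) :
    ρ g (ρ n v) = ρ (MulAut.conjNormal g n : N) (ρ g v) := by
  rw [← Module.End.mul_apply, ← map_mul, ← Module.End.mul_apply, ← map_mul]
  simp [MulAut.conjNormal_apply]

/-- If an element of `F[N]` kills all irreducible representations except `σ` and does not kill
the irreducible representation `ρ` of `G`, then `σ` embeds into `ρ`. -/
theorem equivHom_ne_bot_of_asAlgebraHom_ne_zero [FiniteDimensional F V] {ρ : Representation F G V}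
    (hρ : IsIrred ρ) {σ : Representation F N W} (hσ : IsIrred σ) {x : MonoidAlgebra F N}
    (hx : ∀ (S : Type) [AddCommGroup S] [Module F S] (τ : Representation F N S), IsIrred τ →
      ¬ RepIso σ τ → τ.asAlgebraHom x = 0)
    (hne : Representation.asAlgebraHom (G := N) (V := V) (ρ.comp N.subtype) x ≠ 0) :
    EquivHom σ (ρ.comp N.subtype) ≠ ⊥ := by
  intro hbot
  have := hρ.1
  set ρN : Representation F N V := ρ.comp N.subtype with hρN
  obtain ⟨U, hU, hirr⟩ := exists_isIrred_restrictSubrep ρN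
  let K : Submodule F V := ⨅ g : G, LinearMap.ker (ρN.asAlgebraHom x ∘ₗ ρ g)
  have hmemK (v : V) : v ∈ K ↔ ∀ g, ρN.asAlgebraHom x (ρ g v) = 0 := by simp [K]
  have hK : IsSubrep ρ K := by
    intro g v hv
    rw [hmemK] at hv ⊢
    intro h
    simpa using hv (h * g)
  have hUK : U ≤ K := by
    intro u hu
    rw [hmemK]
    intro g
    let T : U →ₗ[F] V := ρ g ∘ₗ U.subtype
    have hT (n : N) (v : U) : T (conjRep (restrictSubrep ρN hU) g⁻¹ n v) = ρN n (T v) := by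
      have := conjRep_conj ρ g (MulAut.conjNormal g⁻¹ n) v
      rw [← MulAut.mul_apply, ← map_mul, mul_inv_cancel, map_one] at this
      exact this
    have hzero : (conjRep (restrictSubrep ρN hU) g⁻¹).asAlgebraHom x = 0 := by
      refine hx _ _ (hirr.conjRep _) ?_
      rintro ⟨e, he⟩
      have hmem : T ∘ₗ e.toLinearMap ∈ EquivHom σ ρN := fun n w ↦ by
        simp only [LinearMap.comp_apply, LinearEquiv.coe_coe, he]
        exact hT n (e w)
      rw [hbot, Submodule.mem_bot] at hmem
      obtain ⟨w, hw⟩ := @exists_ne W hσ.1 0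
      have hTw : ρ g (e w : V) = 0 := LinearMap.congr_fun hmem w
      have : (e w : V) = 0 := by
        have := congrArg (ρ g⁻¹) hTw
        simpa using this
      exact hw (by simpa using this)
    have := asAlgebraHom_apply_of_intertwining T hT x ⟨u, hu⟩
    rw [hzero] at this
    simpa [T] using this.symm
  have hU0 : U ≠ ⊥ := Submodule.nontrivial_iff_ne_bot.mp hirr.1
  have hKtop : K = ⊤ := (hρ.2 K hK).resolve_left fun h ↦ hU0 (le_bot_iff.mp (h ▸ hUK))
  refine hne (LinearMap.ext fun v ↦ ?_)
  have hv : v ∈ K := hKtop ▸ Submodule.mem_top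
  simpa using (hmemK v).mp hv 1

theorem exists_repIso_dual_conjRep [FiniteDimensional F W]
    {ρ : Representation F G V} (hρ : IsIrred ρ) (hdual : IsSelfDual ρ)
    {σ : Representation F N W} (hσ : IsIrred σ) (h : EquivHom σ (ρ.comp N.subtype) ≠ ⊥) :
    ∃ g : G, RepIso σ.dual (conjRep σ g) := by
  obtain ⟨ι, hι, hι0⟩ := Submodule.exists_mem_ne_zero_of_ne_bot h
  replace hι (n : N) (w : W) : ι (σ n w) = ρ n (ι w) := hι n w
  obtain ⟨e, he⟩ := hdual
  let π : V →ₗ[F] Module.Dual F W := Module.Dual.transpose ι ∘ₗ e.toLinearMap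
  have hπ (n : N) (v : V) : π (ρ n v) = σ.dual n (π v) := by
    ext w
    have : ρ (n : G)⁻¹ (ι w) = ι (σ n⁻¹ w) := (hι n⁻¹ w).symm
    simp [π, he, this, Module.Dual.transpose_apply]
  have hπ0 : π ≠ 0 := by
    refine fun h0 ↦ hι0 (LinearMap.ext fun w ↦ ?_)
    refine (Module.forall_dual_apply_eq_zero_iff F (ι w)).mp fun f ↦ ?_
    have := LinearMap.congr_fun (LinearMap.congr_fun h0 (e.symm f)) w
    simpa [π, Module.Dual.transpose_apply] using this
  obtain ⟨g, hg⟩ : ∃ g : G, π ∘ₗ ρ g ∘ₗ ι ≠ 0 := by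
    by_contra! hall
    let K : Submodule F V := ⨅ g : G, LinearMap.ker (π ∘ₗ ρ g)
    have hmemK (v : V) : v ∈ K ↔ ∀ g, π (ρ g v) = 0 := by simp [K]
    have hK : IsSubrep ρ K := by
      intro g v hv
      rw [hmemK] at hv ⊢
      intro k
      simpa using hv (k * g)
    rcases hρ.2 K hK with h' | h'
    · refine hι0 (LinearMap.ext fun w ↦ ?_)
      have : ι w ∈ K := (hmemK _).mpr fun g ↦ LinearMap.congr_fun (hall g) w
      simpa [h'] using this
    · refine hπ0 (LinearMap.ext fun v ↦ ?_)
      have : v ∈ K := h' ▸ Submodule.mem_top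
      simpa using (hmemK v).mp this 1
  refine ⟨g⁻¹, ((hσ.conjRep g⁻¹).repIso_of_ne_zero hσ.dual (π ∘ₗ ρ g ∘ₗ ι)
    (fun n w ↦ ?_) hg).symm⟩
  have := conjRep_conj ρ g (MulAut.conjNormal g⁻¹ n) (ι w)
  rw [← MulAut.mul_apply, ← map_mul, mul_inv_cancel, map_one, MulAut.one_apply, ← hι] at this
  change π (ρ g (ι (σ (MulAut.conjNormal g⁻¹ n) w))) = _
  rw [this, hπ]
  rfl

end Clifford

section ClassFunctions

variable {F : Type} [Field F] {G : Type} [Group G]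
variable {W : Type} [AddCommGroup W] [Module F W]

theorem exists_sum_character [Finite G] (hs : IsSplitting F G) {c : G → F}
    (hc : ∀ g h, c (g * h) = c (h * g)) (hnil : ∀ x, IsNilpotent x → linearExtension c x = 0) :
    ∃ (n : ℕ) (d : Fin n → ℕ) (ρ : ∀ i, Representation F G (Fin (d i) → F)) (b : Fin n → F),
      (∀ i, IsIrred (ρ i)) ∧ c = fun g ↦ ∑ i, b i * (ρ i).character g := by
  obtain ⟨n, d, ρ, ε, hirr, -, -, -, hexp⟩ := exists_irreducibles hs
  refine ⟨n, d, ρ, fun i ↦ linearExtension c (ε i), hirr, funext fun g ↦ ?_⟩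
  have := hexp _ (linearExtension_mul_comm hc) hnil (MonoidAlgebra.single g 1)
  simpa [Representation.character] using this

theorem exists_linearExtension_character_eq_one [Finite G] (hs : IsSplitting F G)
    {σ : Representation F G W} (hσ : IsIrred σ) :
    ∃ e : MonoidAlgebra F G, linearExtension σ.character e = 1 ∧
      ∀ (S : Type) [AddCommGroup S] [Module F S] (τ : Representation F G S), IsIrred τ →
        ¬ RepIso σ τ → τ.asAlgebraHom e = 0 := by
  obtain ⟨n, d, ρ, ε, hirr, hε, htr, hall, -⟩ := exists_irreducibles hs
  obtain ⟨i, hi⟩ := hall W σ hσ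
  refine ⟨ε i, by rw [← hi.character_eq, linearExtension_character, htr], ?_⟩
  intro S _ _ τ hτ hστ
  obtain ⟨j, hj⟩ := hall S τ hτ
  have hji : j ≠ i := by
    rintro rfl
    obtain ⟨e₁, h₁⟩ := hi.symm
    obtain ⟨e₂, h₂⟩ := hj
    exact hστ ⟨e₁.trans e₂, fun g v ↦ by simp [h₁, h₂]⟩
  obtain ⟨f, hf⟩ := hj
  refine LinearMap.ext fun v ↦ ?_
  have := asAlgebraHom_apply_of_intertwining f.toLinearMap hf (ε i) (f.symm v)
  simpa [hε i j hji] using this.symm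

theorem linearExtension_character_eq_ite {σ : Representation F G W} {e : MonoidAlgebra F G}
    (he : linearExtension σ.character e = 1)
    (hzero : ∀ (S : Type) [AddCommGroup S] [Module F S] (τ : Representation F G S), IsIrred τ →
      ¬ RepIso σ τ → τ.asAlgebraHom e = 0)
    {S : Type} [AddCommGroup S] [Module F S] {τ : Representation F G S} (hτ : IsIrred τ)
    [Decidable (τ.character = σ.character)] :
    linearExtension τ.character e = if τ.character = σ.character then 1 else 0 := by
  split_ifs with h
  · rw [h, he]
  · rw [linearExtension_character, hzero S τ hτ fun h' ↦ h h'.character_eq.symm, map_zero]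

/-- A functional on class functions that takes equal values on dual irreducible characters is
determined, in characteristic two, by its values on the self-dual ones. -/
theorem exists_isSelfDual_of_apply_ne_zero [Finite G] [CharP F 2] (hs : IsSplitting F G)
    {c : G → F} (hc : ∀ g h, c (g * h) = c (h * g))
    (hnil : ∀ x, IsNilpotent x → linearExtension c x = 0) (hinv : ∀ g, c g⁻¹ = c g)
    (L : (G → F) →ₗ[F] F)
    (hL : ∀ (d : ℕ) (ρ : Representation F G (Fin d → F)), L (fun g ↦ ρ.character g⁻¹) =
      L ρ.character) (hne : L c ≠ 0) :
    ∃ (d : ℕ) (ρ : Representation F G (Fin d → F)),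
      IsIrred ρ ∧ IsSelfDual ρ ∧ L ρ.character ≠ 0 := by
  obtain ⟨n, d, ρ, ε, hirr, hε, htr, hall, hexp⟩ := exists_irreducibles hs
  have hδ (i j : Fin n) : linearExtension (ρ i).character (ε j) = if i = j then 1 else 0 := by
    rw [linearExtension_character]
    split_ifs with h
    · rw [h, htr]
    · rw [hε j i h, map_zero]
  have hinj : Function.Injective fun i ↦ (ρ i).character := fun i j hij ↦ by
    by_contra h
    have h' := hδ j i
    rw [← show (ρ i).character = (ρ j).character from hij, hδ i i] at h'
    simp [Ne.symm h] at h'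
  choose star hstar using fun i ↦ hall _ (ρ i).dual (hirr i).dual
  have hχ (i g) : (ρ (star i)).character g = (ρ i).character g⁻¹ := by
    rw [(hstar i).character_eq, Representation.char_dual]
  have hinvol (i) : star (star i) = i := hinj (funext fun g ↦ by simp [hχ])
  set a : Fin n → F := fun i ↦ linearExtension c (ε i) with ha
  have hsum (g) : c g = ∑ i, a i * (ρ i).character g := by
    have := hexp _ (linearExtension_mul_comm hc) hnil (MonoidAlgebra.single g 1)
    simpa [Representation.character] using this
  have ha_star (j) : a (star j) = a j := by
    have : c = fun g ↦ ∑ i, a i * (ρ (star i)).character g := funext fun g ↦ by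
      simp [← hinv g, hsum, hχ]
    rw [ha]
    change linearExtension c (ε (star j)) = a j
    rw [this, linearExtension_sum_mul]
    simp [hδ, (Function.LeftInverse.injective hinvol).eq_iff]
  have hL_star (i) : L (ρ (star i)).character = L (ρ i).character := by
    rw [← hL _ (ρ i), ← show (ρ (star i)).character = _ from funext (hχ i)]
  have hLc : L c = ∑ i, a i * L (ρ i).character := by
    have : c = ∑ i, a i • (ρ i).character := funext fun g ↦ by simp [hsum]
    rw [this]
    simp
  by_contra! hall'
  refine hne (hLc.trans (Finset.sum_involution (fun i _ ↦ star i) (fun i _ ↦ ?_)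
    (fun i _ hi h ↦ hi ?_) (fun i _ ↦ Finset.mem_univ _) fun i _ ↦ hinvol i))
  · rw [ha_star, hL_star, CharTwo.add_self_eq_zero]
  · have hself := hstar i
    rw [h] at hself
    rw [hall' _ (ρ i) (hirr i) hself, mul_zero]

end ClassFunctions

section Orbits

variable {F : Type} [Field F] {G : Type} [Group G] {N : Subgroup G}
variable {W : Type} [AddCommGroup W] [Module F W]

/-- The extension of a function on a subgroup by zero. -/
noncomputable def extendZero (φ : N → F) (g : G) : F :=
  open Classical in if h : g ∈ N then φ ⟨g, h⟩ else 0

theorem extendZero_coe (φ : N → F) (n : N) : extendZero φ n = φ n := by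
  simp [extendZero]

theorem extendZero_of_notMem (φ : N → F) {g : G} (hg : g ∉ N) : extendZero φ g = 0 := by
  simp [extendZero, hg]

/-- The sum over the `G`-orbit of `φ`, extended by zero, where `G` acts by conjugation. -/
noncomputable def orbitSum [Fintype G] (φ : N → F) (g : G) : F :=
  open Classical in
    ∑ χ ∈ Finset.univ.image fun h : G ↦ fun x ↦ extendZero φ (h * x * h⁻¹), χ g

theorem orbitSum_conj [Fintype G] (φ : N → F) (k g : G) :
    orbitSum φ (k * g * k⁻¹) = orbitSum φ g := by
  classical
  refine Finset.sum_nbij' (fun χ x ↦ χ (k * x * k⁻¹)) (fun χ x ↦ χ (k⁻¹ * x * k)) ?_ ?_ ?_ ?_ ?_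
  · simp only [Finset.mem_image, Finset.mem_univ, true_and]
    rintro _ ⟨h, rfl⟩
    exact ⟨h * k, by simp [mul_assoc]⟩
  · simp only [Finset.mem_image, Finset.mem_univ, true_and]
    rintro _ ⟨h, rfl⟩
    exact ⟨h * k⁻¹, by simp [mul_assoc]⟩
  · intro χ _
    simp [mul_assoc]
  · intro χ _
    simp [mul_assoc]
  · simp

theorem orbitSum_mul_comm [Fintype G] (φ : N → F) (g h : G) :
    orbitSum φ (g * h) = orbitSum φ (h * g) := by
  rw [← orbitSum_conj φ g (h * g)]
  simp [mul_assoc]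

variable [N.Normal]

theorem extendZero_conj (φ : N → F) (h : G) (n : N) :
    extendZero φ (h * n * h⁻¹) = φ (MulAut.conjNormal h n) := by
  rw [← extendZero_coe φ, MulAut.conjNormal_apply]

theorem character_conjRep (σ : Representation F N W) (g : G) (n : N) :
    (conjRep σ g).character n = σ.character (MulAut.conjNormal g n) := rfl

/-- If `σ.dual` is conjugate to `σ`, then a conjugation-invariant combination of characters and
its dual contain `σ` with the same coefficient. -/
theorem linearExtension_comp_inv [Finite G] [FiniteDimensional F W] (hs : IsSplitting F N)
    {σ : Representation F N W} {e : MonoidAlgebra F N}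
    (he : linearExtension σ.character e = 1)
    (hzero : ∀ (S : Type) [AddCommGroup S] [Module F S] (τ : Representation F N S), IsIrred τ →
      ¬ RepIso σ τ → τ.asAlgebraHom e = 0)
    {g : G} (hg : ∀ n : N, σ.character n⁻¹ = σ.character (MulAut.conjNormal g n)) {c : N → F}
    (hc : ∀ n m, c (n * m) = c (m * n)) (hnil : ∀ x, IsNilpotent x → linearExtension c x = 0)
    (hconj : ∀ n : N, c (MulAut.conjNormal g⁻¹ n) = c n) :
    linearExtension (fun n ↦ c n⁻¹) e = linearExtension c e := by
  classical
  obtain ⟨k, d, ψ, b, hirr, rfl⟩ := exists_sum_character hs hc hnil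
  have hright : (fun n ↦ ∑ i, b i * (ψ i).character n) =
      fun n ↦ ∑ i, b i * (conjRep (ψ i) g⁻¹).character n := funext fun n ↦ (hconj n).symm
  have hleft : (fun n ↦ ∑ i, b i * (ψ i).character n⁻¹) =
      fun n ↦ ∑ i, b i * (ψ i).dual.character n := by simp
  change linearExtension (fun n ↦ ∑ i, b i * (ψ i).character n⁻¹) e = _
  rw [hleft, hright, linearExtension_sum_mul, linearExtension_sum_mul]
  refine Finset.sum_congr rfl fun i _ ↦ ?_
  rw [linearExtension_character_eq_ite he hzero (hirr i).dual,
    linearExtension_character_eq_ite he hzero ((hirr i).conjRep g⁻¹)]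
  congr 2
  rw [eq_iff_iff, funext_iff, funext_iff]
  simp only [Representation.char_dual, character_conjRep]
  refine ⟨fun h n ↦ ?_, fun h n ↦ ?_⟩
  · have := h (MulAut.conjNormal g⁻¹ n)⁻¹
    rw [inv_inv, hg, ← MulAut.mul_apply, ← map_mul] at this
    simpa using this
  · have := h (MulAut.conjNormal g n⁻¹)
    rw [← hg, inv_inv, ← MulAut.mul_apply, ← map_mul] at this
    simpa using this

theorem orbitSum_inv [Fintype G] {φ : N → F} {k : G}
    (hk : ∀ n : N, φ n⁻¹ = φ (MulAut.conjNormal k n)) (g : G) :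
    orbitSum φ g⁻¹ = orbitSum φ g := by
  classical
  have hext (x : G) : extendZero φ x⁻¹ = extendZero φ (k * x * k⁻¹) := by
    by_cases hx : x ∈ N
    · lift x to N using hx
      rw [extendZero_conj, ← hk, ← N.coe_inv, extendZero_coe]
    · rw [extendZero_of_notMem _ (by simpa using hx), extendZero_of_notMem]
      exact fun h ↦ hx (by
        simpa [mul_assoc] using ‹N.Normal›.conj_mem _ h k⁻¹)
  have hmap (χ : G → F) (hχ : χ ∈ Finset.univ.image fun h : G ↦ fun x ↦
      extendZero φ (h * x * h⁻¹)) : (fun x ↦ χ x⁻¹) ∈ Finset.univ.image fun h : G ↦ fun x ↦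
      extendZero φ (h * x * h⁻¹) := by
    simp only [Finset.mem_image, Finset.mem_univ, true_and] at hχ ⊢
    obtain ⟨h, rfl⟩ := hχ
    refine ⟨k * h, funext fun x ↦ ?_⟩
    have := hext (h * x * h⁻¹)
    simpa [mul_assoc] using this.symm
  exact Finset.sum_nbij' (fun χ x ↦ χ x⁻¹) (fun χ x ↦ χ x⁻¹) hmap hmap (by simp) (by simp)
    (by simp)

theorem linearExtension_orbitSum [Fintype G] {σ : Representation F N W} (hσ : IsIrred σ)
    {e : MonoidAlgebra F N} (he : linearExtension σ.character e = 1)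
    (hzero : ∀ (S : Type) [AddCommGroup S] [Module F S] (τ : Representation F N S), IsIrred τ →
      ¬ RepIso σ τ → τ.asAlgebraHom e = 0) :
    linearExtension (fun n : N ↦ orbitSum σ.character n) e = 1 := by
  classical
  have hone := linearExtension_sum_mul (G := N)
    (Finset.univ.image fun h : G ↦ fun x ↦ extendZero σ.character (h * x * h⁻¹)) (fun _ ↦ 1)
    (fun χ n ↦ χ n) e
  simp only [one_mul] at hone
  refine hone.trans ((Finset.sum_eq_single (extendZero σ.character) ?_ ?_).trans ?_)
  · simp only [Finset.mem_image, Finset.mem_univ, true_and]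
    rintro _ ⟨h, rfl⟩ hne
    have hchar : (fun n : N ↦ extendZero σ.character (h * n * h⁻¹)) = (conjRep σ h).character :=
      funext fun n ↦ extendZero_conj _ h n
    rw [hchar, linearExtension_character_eq_ite he hzero (hσ.conjRep h), if_neg]
    refine fun heq ↦ hne (funext fun x ↦ ?_)
    by_cases hx : x ∈ N
    · lift x to N using hx
      rw [extendZero_conj, ← character_conjRep, heq, extendZero_coe]
    · rw [extendZero_of_notMem _ hx, extendZero_of_notMem]
      exact fun h' ↦ hx (by simpa [mul_assoc] using ‹N.Normal›.conj_mem _ h' h⁻¹)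
  · refine fun h ↦ (h (Finset.mem_image.mpr ⟨1, Finset.mem_univ _, ?_⟩)).elim
    simp
  · simp only [extendZero_coe, he]

theorem orbitSum_character_pow_two_pow [Fintype G] [CharP F 2] (σ : Representation F N W) {a : ℕ}
    (ha : ∀ g : G, (g ^ 2 ^ a) ^ 2 ^ a = g ^ 2 ^ a) (n : N) :
    orbitSum σ.character ((n : G) ^ 2 ^ a) = orbitSum σ.character n := by
  classical
  refine Finset.sum_congr rfl ?_
  simp only [Finset.mem_image, Finset.mem_univ, true_and]
  rintro _ ⟨h, rfl⟩
  beta_reduce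
  rw [← N.coe_pow, extendZero_conj, extendZero_conj, map_pow, character_pow_two_pow]
  exact fun n ↦ Subtype.ext (ha n)

end Orbits

theorem exists_isSelfDual_equivHom_ne_bot {F : Type} [Field F] [CharP F 2]
    {G : Type} [Group G] [Finite G] {N : Subgroup G} [N.Normal]
    (hsG : IsSplitting F G) (hsN : IsSplitting F N)
    {W : Type} [AddCommGroup W] [Module F W] [FiniteDimensional F W]
    {σ : Representation F N W} (hσ : IsIrred σ) {g : G} (hg : RepIso σ.dual (conjRep σ g)) :
    ∃ (d : ℕ) (ρ : Representation F G (Fin d → F)),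
      IsIrred ρ ∧ IsSelfDual ρ ∧ EquivHom σ (ρ.comp N.subtype) ≠ ⊥ := by
  have := Fintype.ofFinite G
  obtain ⟨e, he, hzero⟩ := exists_linearExtension_character_eq_one hsN hσ
  obtain ⟨a, ha0, ha⟩ := exists_pow_two_pow_idempotent G
  have hχ (n : N) : σ.character n⁻¹ = σ.character (MulAut.conjNormal g n) := by
    rw [← character_conjRep, ← hg.character_eq, Representation.char_dual]
  let L : (G → F) →ₗ[F] F := LinearMap.applyₗ e ∘ₗ
    ((MonoidAlgebra.basis N F).constr F).toLinearMap ∘ₗ LinearMap.funLeft F F N.subtype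
  have hL (c : G → F) : L c = linearExtension (fun n : N ↦ c n) e := rfl
  have hcomm (x y : G) : orbitSum σ.character ((x * y) ^ 2 ^ a) =
      orbitSum σ.character ((y * x) ^ 2 ^ a) := by
    rw [← orbitSum_conj σ.character y ((x * y) ^ 2 ^ a), ← conj_pow]
    simp [mul_assoc]
  have hLdual (d : ℕ) (ρ : Representation F G (Fin d → F)) :
      L (fun x ↦ ρ.character x⁻¹) = L ρ.character := by
    let ρN : Representation F N (Fin d → F) := ρ.comp N.subtype
    refine linearExtension_comp_inv hsN he hzero hχ (c := ρN.character)
      (fun n m ↦ ρN.char_mul_comm m n) (fun x hx ↦ ?_) fun n ↦ ?_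
    · rw [linearExtension_character]
      exact (LinearMap.isNilpotent_trace_of_isNilpotent (hx.map ρN.asAlgebraHom)).eq_zero
    · change ρ.character (MulAut.conjNormal g⁻¹ n : N) = ρ.character n
      rw [MulAut.conjNormal_apply, Representation.char_conj]
  have hLne : L (fun x ↦ orbitSum σ.character (x ^ 2 ^ a)) ≠ 0 := by
    simp only [hL, orbitSum_character_pow_two_pow σ ha]
    rw [linearExtension_orbitSum hσ he hzero]
    exact one_ne_zero
  obtain ⟨d, ρ, hρ, hdual, hne⟩ := exists_isSelfDual_of_apply_ne_zero hsG hcomm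
    (fun x hx ↦ linearExtension_eq_zero_of_isNilpotent (orbitSum_mul_comm σ.character) ha0 ha hx)
    (fun x ↦ by rw [inv_pow, orbitSum_inv hχ]) L hLdual hLne
  refine ⟨d, ρ, hρ, hdual, equivHom_ne_bot_of_asAlgebraHom_ne_zero hρ hσ hzero fun h0 ↦ hne ?_⟩
  rw [hL]
  change linearExtension (Representation.character (G := N) (V := Fin d → F)
    (ρ.comp N.subtype)) e = 0
  rw [linearExtension_character, h0, map_zero]

/-- an irreducible FN-module W occurs in the restriction of some self-dual
irreducible FG-module iff W is G-conjugate to its dual. -/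
theorem stmt_10 {F : Type} [Field F] [CharP F 2] [PerfectField F]
    {G : Type} [Group G] [Finite G] (N : Subgroup G) [N.Normal]
    (hsplit : ∀ H : Subgroup G, IsSplitting F ↥H)
    {W : Type} [AddCommGroup W] [Module F W] [FiniteDimensional F W]
    (σ : Representation F ↥N W) (hirr : IsIrred σ) :
    (∃ M : RepOn F G, FiniteDimensional F M.carrier ∧ IsIrred M.rep ∧ IsSelfDual M.rep ∧
        EquivHom σ (M.rep.comp N.subtype) ≠ ⊥) ↔
      (∃ g : G, RepIso σ.dual (σ.comp (MulAut.conjNormal g).toMonoidHom)) := by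
  constructor
  · rintro ⟨M, hfd, hM, hdual, hne⟩
    exact exists_repIso_dual_conjRep hM hdual hirr hne
  · rintro ⟨g, hg⟩
    have hsG : IsSplitting F G := isSplitting_of_top (hsplit ⊤)
    obtain ⟨d, ρ, hρ, hdual, hne⟩ := exists_isSelfDual_equivHom_ne_bot hsG (hsplit N) hirr hg
    exact ⟨⟨Fin d → F, ρ⟩, inferInstanceAs (FiniteDimensional F (Fin d → F)), hρ, hdual, hne⟩
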